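/- arXiv:2503.09544 — 2 statements merged into one kernel-verified Lean document; each statement's English description precedes it below -/
import Mathlib

section
/- Let n ∈ ℕ with n ≥ 36, let ε ≤ 1/4, and set Δ := 10^{−5}, c := 0.999. If f : {0,1}^n × {0,1}^n → {0,1} is drawn uniformly at random from F*_ε (case m = 1), then with probability at least 1 − 2^{−2^{n − c·log₂(1/(3/4+Δ))}} the function f has the following property: for every q ∈ ℕ with q < n/2 + (1/2)·log₂( (3/4+Δ)^c · (1−(3/4+Δ)^{1−c}) · log₂((3/4+Δ)/(3/4)) / (8·log₂(1/Δ)) ), every q-qubit strategy T for QPV_rout^f (the case m = 1 with γ = 0) satisfies ω_T ≤ (3/4 + 10^{−5})^{0.999} · (1 + 3·√(6·ln 2)·2^{−n}) + 21·10^{−5}. -/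
open Matrix Kronecker Finset
open scoped ComplexOrder

noncomputable section

/-- Bit strings of length `n`. -/
abbrev Bits (n : ℕ) := Fin n → Bool

/-- Binary entropy function `h(p) = -p log₂ p - (1-p) log₂ (1-p)` (with `h 0 = 0`). -/
def binEnt (p : ℝ) : ℝ := -(p * Real.logb 2 p) - (1 - p) * Real.logb 2 (1 - p)

/-- `μ_γ = 2^{γ+h(γ)} (1/2 + 1/(2√2))`. -/
def muGamma (γ : ℝ) : ℝ := (2 : ℝ) ^ (γ + binEnt γ) * (1 / 2 + 1 / (2 * Real.sqrt 2))

/-- The EPR pair `Φ⁺ = (|00⟩+|11⟩)/√2 ∈ ℂ² ⊗ ℂ²`. -/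
def phiPlus : Bool × Bool → ℂ := fun p => if p.1 = p.2 then (1 / (Real.sqrt 2 : ℂ)) else 0

/-- The rank-one projector `|Φ⁺⟩⟨Φ⁺|`. -/
def projPhiPlus : Matrix (Bool × Bool) (Bool × Bool) ℂ :=
  Matrix.vecMulVec phiPlus (star phiPlus)

/-- The two-qubit measurement operator: `|Φ⁺⟩⟨Φ⁺|` for outcome `a = 0`,
`I − |Φ⁺⟩⟨Φ⁺|` for outcome `a = 1`. -/
def Nbit (a : Bool) : Matrix (Bool × Bool) (Bool × Bool) ℂ :=
  if a then 1 - projPhiPlus else projPhiPlus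

/-- `N^z_a` on `V ⊗ A' ⊗ B'` with `V = (ℂ²)^{⊗m}`, `A' = (ℂ²)^{⊗m} ⊗ E_A`,
`B' = (ℂ²)^{⊗m} ⊗ E_B`: for each `i`, acts on the `i`-th qubit of `V` together with the
`i`-th output qubit of `A'` (if `z_i = 0`) or of `B'` (if `z_i = 1`) as `Nbit (a i)`,
and as the identity elsewhere. -/
def Nmat (m : ℕ) {EA EB : Type*} [DecidableEq EA] [DecidableEq EB] (z a : Bits m) :
    Matrix (Bits m × (Bits m × EA) × (Bits m × EB))
      (Bits m × (Bits m × EA) × (Bits m × EB)) ℂ :=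
  fun r c =>
    (if r.2.1.2 = c.2.1.2 then 1 else 0) * (if r.2.2.2 = c.2.2.2 then 1 else 0) *
      ∏ i : Fin m,
        (if z i then
          (if r.2.1.1 i = c.2.1.1 i then 1 else 0) *
            Nbit (a i) (r.1 i, r.2.2.1 i) (c.1 i, c.2.2.1 i)
        else
          (if r.2.2.1 i = c.2.2.1 i then 1 else 0) *
            Nbit (a i) (r.1 i, r.2.1.1 i) (c.1 i, c.2.1.1 i))

/-- Hamming weight of a bit string. -/
def hw {m : ℕ} (a : Bits m) : ℕ := (Finset.univ.filter (fun i => a i = true)).card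

/-- The state `Ψ_{xy} = (I_V ⊗ K^{xy} ⊗ L^{xy})ψ`. -/
def routPsi (n m eA eB : ℕ)
    (ψ : Bits m × (Bits m × Fin eA) × (Bits m × Fin eB) → ℂ)
    (K : Bits n → Bits n → Matrix (Bits m × Fin eA) (Bits m × Fin eA) ℂ)
    (L : Bits n → Bits n → Matrix (Bits m × Fin eB) (Bits m × Fin eB) ℂ)
    (x y : Bits n) : Bits m × (Bits m × Fin eA) × (Bits m × Fin eB) → ℂ :=
  ((1 : Matrix (Bits m) (Bits m) ℂ) ⊗ₖ (K x y ⊗ₖ L x y)).mulVec ψ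

/-- `q_f(z)`: the fraction of input pairs `(x,y)` mapped by `f` to `z`. -/
def qf (n m : ℕ) (f : Bits n × Bits n → Bits m) (z : Bits m) : ℝ :=
  ((Finset.univ.filter (fun p : Bits n × Bits n => f p = z)).card : ℝ) / 2 ^ (2 * n)

/-- The set `F*_ε` of functions whose output distribution is close to uniform. -/
def Fstar (n m : ℕ) (ε : ℝ) : Set (Bits n × Bits n → Bits m) :=
  {f | ∀ z : Bits m,
    |qf n m f z - (2 : ℝ) ^ (-(m : ℝ))| ≤
      Real.sqrt (3 * Real.log (2 / ε)) * (2 : ℝ) ^ (-(n : ℝ) - m / 2)}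

/-- Split a bit string of length `p + q` into its two halves. -/
def splitBits {p q : ℕ} (w : Bits (p + q)) : Bits p × Bits q :=
  (fun i => w (Fin.castAdd q i), fun j => w (Fin.natAdd p j))

/-- Transport a bit string along an equality of lengths. -/
def castBits {p q : ℕ} (h : p = q) (w : Bits p) : Bits q := fun i => w (Fin.cast h.symm i)

/-- A `q`-qubit strategy for `QPV_rout^{f:n→m}`: a splitting of `q` qubits on each side
into kept/communicated registers, a shared state `φ`, local unitaries `U^x`, `V^y`, and
response unitaries `K^{xy}`, `L^{xy}` on the regrouped registers
`A' = A_k ⊗ B_c ≅ (ℂ²)^{⊗m} ⊗ (ℂ²)^{⊗rA}`, `B' = B_k ⊗ A_c ≅ (ℂ²)^{⊗m} ⊗ (ℂ²)^{⊗rB}`,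
whose first `m` qubit factors are the designated output registers. -/
structure RoutStrategy (n m q : ℕ) where
  qAk : ℕ
  qAc : ℕ
  qBk : ℕ
  qBc : ℕ
  rA : ℕ
  rB : ℕ
  hqA : qAk + qAc = q
  hqB : qBk + qBc = q
  hrA : qAk + qBc = m + rA
  hrB : qBk + qAc = m + rB
  φ : Bits m × (Bits qAk × Bits qAc) × (Bits qBk × Bits qBc) → ℂ
  hφ : ∑ i, ‖φ i‖ ^ 2 = 1
  U : Bits n → Matrix (Bits qAk × Bits qAc) (Bits qAk × Bits qAc) ℂ
  V : Bits n → Matrix (Bits qBk × Bits qBc) (Bits qBk × Bits qBc) ℂ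
  hU : ∀ x, U x ∈ Matrix.unitaryGroup (Bits qAk × Bits qAc) ℂ
  hV : ∀ y, V y ∈ Matrix.unitaryGroup (Bits qBk × Bits qBc) ℂ
  K : Bits n → Bits n → Matrix (Bits qAk × Bits qBc) (Bits qAk × Bits qBc) ℂ
  L : Bits n → Bits n → Matrix (Bits qBk × Bits qAc) (Bits qBk × Bits qAc) ℂ
  hK : ∀ x y, K x y ∈ Matrix.unitaryGroup (Bits qAk × Bits qBc) ℂ
  hL : ∀ x y, L x y ∈ Matrix.unitaryGroup (Bits qBk × Bits qAc) ℂ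

/-- The state `Ψ_{xy} = (I_V ⊗ K^{xy} ⊗ L^{xy})(I_V ⊗ U^x ⊗ V^y)φ`, viewed in
`V ⊗ A' ⊗ B'` via the canonical reordering and regrouping of tensor factors. -/
def RoutStrategy.Psi {n m q : ℕ} (T : RoutStrategy n m q) (x y : Bits n) :
    Bits m × (Bits m × Bits T.rA) × (Bits m × Bits T.rB) → ℂ :=
  fun p =>
    (((1 : Matrix (Bits m) (Bits m) ℂ) ⊗ₖ (T.K x y ⊗ₖ T.L x y)).mulVec
        (fun u : Bits m × (Bits T.qAk × Bits T.qBc) × (Bits T.qBk × Bits T.qAc) =>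
          (((1 : Matrix (Bits m) (Bits m) ℂ) ⊗ₖ (T.U x ⊗ₖ T.V y)).mulVec T.φ)
            (u.1, (u.2.1.1, u.2.2.2), (u.2.2.1, u.2.1.2))))
      (p.1, splitBits (castBits T.hrA.symm (Fin.append p.2.1.1 p.2.1.2)),
        splitBits (castBits T.hrB.symm (Fin.append p.2.2.1 p.2.2.2)))

/-- The winning probability `ω_T` of a routing strategy, with error tolerance `γ`. -/
def RoutStrategy.win {n m q : ℕ} (T : RoutStrategy n m q) (γ : ℝ)
    (f : Bits n × Bits n → Bits m) : ℝ :=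
  (1 / 2 ^ (2 * n) : ℝ) * ∑ x : Bits n, ∑ y : Bits n,
    ∑ a ∈ Finset.univ.filter (fun a : Bits m => (hw a : ℝ) ≤ γ * m),
      (star (T.Psi x y) ⬝ᵥ (Nmat m (f (x, y)) a).mulVec (T.Psi x y)).re

section Counting

lemma exp_add_exp_le {a b μ t : ℝ} (ha : a ∈ Set.Icc (0 : ℝ) 1) (hb : b ∈ Set.Icc (0 : ℝ) 1)
    (hab : a + b ≤ 2 * μ) (ht : 0 ≤ t) :
    Real.exp (t * a) + Real.exp (t * b) ≤ 2 * Real.exp (t * μ + t ^ 2 / 8) := by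
  have h1 : Real.exp (t * a) + Real.exp (t * b) =
      2 * (Real.exp (t * ((a + b) / 2)) * Real.cosh (t * ((a - b) / 2))) := by
    rw [Real.cosh_eq]
    have e1 : Real.exp (t * a) =
        Real.exp (t * ((a + b) / 2)) * Real.exp (t * ((a - b) / 2)) := by
      rw [← Real.exp_add]; ring_nf
    have e2 : Real.exp (t * b) =
        Real.exp (t * ((a + b) / 2)) * Real.exp (-(t * ((a - b) / 2))) := by
      rw [← Real.exp_add]; ring_nf
    rw [e1, e2]; ring
  have h2 : Real.cosh (t * ((a - b) / 2)) ≤ Real.exp (t ^ 2 / 8) := by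
    refine (Real.cosh_le_exp_half_sq _).trans (Real.exp_le_exp.2 ?_)
    have : (a - b) ^ 2 ≤ 1 := by
      rw [sq_le_one_iff_abs_le_one, abs_le]
      constructor <;> linarith [ha.1, ha.2, hb.1, hb.2]
    nlinarith [mul_le_mul_of_nonneg_left this (sq_nonneg t)]
  rw [h1, Real.exp_add]
  gcongr
  linarith

lemma sum_bits_one (h : Bits 1 → ℝ) :
    ∑ b, h b = h (fun _ => false) + h (fun _ => true) := by
  rw [← (Equiv.funUnique (Fin 1) Bool).symm.sum_comp h]
  simp only [Fintype.univ_bool, mem_singleton, Bool.true_eq_false, not_false_eq_true,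
    sum_insert, sum_singleton]
  rw [add_comm]
  rfl

/-- A Chernoff–Hoeffding bound for a uniformly random function `X → Bits 1`. -/
lemma card_filter_lt_sum_le {X : Type*} [Fintype X] [DecidableEq X] {μ δ : ℝ} (hδ : 0 ≤ δ)
    (g : X → Bits 1 → ℝ) (hg : ∀ x b, g x b ∈ Set.Icc (0 : ℝ) 1)
    (hμ : ∀ x, ∑ b, g x b ≤ 2 * μ) :
    (((univ : Finset (X → Bits 1)).filter
      (fun f => (μ + δ) * Fintype.card X < ∑ x, g x (f x))).card : ℝ) ≤
      2 ^ Fintype.card X * Real.exp (-(2 * δ ^ 2 * Fintype.card X)) := by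
  set S := (univ : Finset (X → Bits 1)).filter
      (fun f => (μ + δ) * Fintype.card X < ∑ x, g x (f x))
  set t : ℝ := 4 * δ
  have key : ∑ f : X → Bits 1, Real.exp (t * ∑ x, g x (f x)) ≤
      (2 * Real.exp (t * μ + t ^ 2 / 8)) ^ Fintype.card X := by
    have : ∑ f : X → Bits 1, Real.exp (t * ∑ x, g x (f x)) =
        ∏ x : X, ∑ b, Real.exp (t * g x b) := by
      rw [Fintype.prod_sum]
      refine sum_congr rfl fun f _ => ?_
      rw [mul_sum, Real.exp_sum]
    rw [this, ← Finset.card_univ, ← prod_const]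
    refine prod_le_prod (fun x _ => sum_nonneg fun b _ => (Real.exp_pos _).le) fun x _ => ?_
    rw [sum_bits_one]
    refine exp_add_exp_le (hg _ _) (hg _ _) ?_ (by positivity)
    have := hμ x
    rwa [sum_bits_one] at this
  have h2 : (S.card : ℝ) * Real.exp (t * ((μ + δ) * Fintype.card X)) ≤
      ∑ f : X → Bits 1, Real.exp (t * ∑ x, g x (f x)) := by
    rw [← nsmul_eq_mul, ← sum_const]
    refine (sum_le_sum (s := S) fun f hf => ?_).trans
      (sum_le_sum_of_subset_of_nonneg (filter_subset _ _) fun _ _ _ => (Real.exp_pos _).le)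
    have := (mem_filter.1 hf).2
    gcongr
  have h3 := h2.trans key
  rw [← le_div_iff₀ (Real.exp_pos _)] at h3
  refine h3.trans (le_of_eq ?_)
  rw [mul_pow, mul_div_assoc, ← Real.exp_nat_mul, ← Real.exp_sub]
  congr 2
  simp only [t]
  ring

end Counting

section Nets

open MeasureTheory Metric ENNReal Module

variable {E : Type*} [NormedAddCommGroup E] [NormedSpace ℝ E] [FiniteDimensional ℝ E]

lemma card_le_of_separated_of_norm_le_one {η : ℝ} (hη : 0 < η) (s : Finset E)
    (hs : ∀ c ∈ s, ‖c‖ ≤ 1) (h : ∀ c ∈ s, ∀ d ∈ s, c ≠ d → η ≤ ‖c - d‖) :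
    (s.card : ℝ) ≤ (1 + 2 / η) ^ finrank ℝ E := by
  borelize E
  let μ : Measure E := Measure.addHaar
  let δ : ℝ := η / 2
  let ρ : ℝ := 1 + η / 2
  have δpos : 0 < δ := by positivity
  have ρpos : 0 < ρ := by positivity
  set A := ⋃ c ∈ s, ball (c : E) δ with hA
  have D : Set.Pairwise (s : Set E) (Function.onFun Disjoint fun c => ball (c : E) δ) := by
    rintro c hc d hd hcd
    apply ball_disjoint_ball
    rw [dist_eq_norm]
    refine le_trans (le_of_eq ?_) (h c hc d hd hcd)
    simp only [δ]; ring
  have A_subset : A ⊆ ball (0 : E) ρ := by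
    refine Set.iUnion₂_subset fun x hx => ?_
    apply ball_subset_ball'
    rw [dist_zero_right]
    have := hs x hx
    simp only [δ, ρ]; linarith
  have I : (s.card : ℝ≥0∞) * ENNReal.ofReal (δ ^ finrank ℝ E) * μ (ball 0 1) ≤
      ENNReal.ofReal (ρ ^ finrank ℝ E) * μ (ball 0 1) :=
    calc
      (s.card : ℝ≥0∞) * ENNReal.ofReal (δ ^ finrank ℝ E) * μ (ball 0 1) = μ A := by
        rw [hA, measure_biUnion_finset D fun c _ => measurableSet_ball]
        simp only [μ.addHaar_ball_of_pos _ δpos, Finset.sum_const, nsmul_eq_mul, mul_assoc]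
      _ ≤ μ (ball (0 : E) ρ) := measure_mono A_subset
      _ = ENNReal.ofReal (ρ ^ finrank ℝ E) * μ (ball 0 1) := by
        simp only [μ.addHaar_ball_of_pos _ ρpos]
  have J : (s.card : ℝ≥0∞) * ENNReal.ofReal (δ ^ finrank ℝ E) ≤
      ENNReal.ofReal (ρ ^ finrank ℝ E) :=
    (ENNReal.mul_le_mul_iff_left (measure_ball_pos _ _ zero_lt_one).ne' measure_ball_lt_top.ne).1 I
  have K := ENNReal.toReal_le_of_le_ofReal (pow_nonneg ρpos.le _) J
  rw [ENNReal.toReal_mul, ENNReal.toReal_ofReal (by positivity), ENNReal.toReal_natCast] at K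
  have e : 1 + 2 / η = ρ / δ := by simp only [ρ, δ]; field_simp; ring
  rw [e, div_pow, le_div_iff₀ (by positivity)]
  exact K

/-- The unit ball of a finite-dimensional real normed space has an `η`-net of size
`(1 + 2 / η) ^ dim`. -/
lemma exists_net (E : Type*) [NormedAddCommGroup E] [NormedSpace ℝ E] [FiniteDimensional ℝ E]
    {η : ℝ} (hη : 0 < η) :
    ∃ s : Finset E, (s.card : ℝ) ≤ (1 + 2 / η) ^ finrank ℝ E ∧ (∀ c ∈ s, ‖c‖ ≤ 1) ∧
      ∀ x : E, ‖x‖ ≤ 1 → ∃ c ∈ s, ‖x - c‖ ≤ η := by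
  classical
  let Q : Finset E → Prop := fun s =>
    (∀ c ∈ s, ‖c‖ ≤ 1) ∧ ∀ c ∈ s, ∀ d ∈ s, c ≠ d → η ≤ ‖c - d‖
  let C : Set ℕ := {k | ∃ s, Q s ∧ s.card = k}
  have hbdd : BddAbove C := by
    refine ⟨⌊(1 + 2 / η) ^ finrank ℝ E⌋₊, ?_⟩
    rintro _ ⟨s, hs, rfl⟩
    exact Nat.le_floor (card_le_of_separated_of_norm_le_one hη s hs.1 hs.2)
  have hne : C.Nonempty := ⟨0, ∅, by simp [Q], rfl⟩
  obtain ⟨s, hs, hcard⟩ := Nat.sSup_mem hne hbdd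
  refine ⟨s, card_le_of_separated_of_norm_le_one hη s hs.1 hs.2, hs.1, fun x hx => ?_⟩
  by_contra! hfar
  have hxs : x ∉ s := fun hxs => by
    have := hfar x hxs
    simp only [sub_self, norm_zero] at this
    linarith
  have hQ : Q (insert x s) := by
    refine ⟨fun c hc => ?_, fun c hc d hd hcd => ?_⟩
    · rcases mem_insert.1 hc with rfl | hc
      exacts [hx, hs.1 c hc]
    · rcases mem_insert.1 hc with rfl | hc' <;> rcases mem_insert.1 hd with rfl | hd'
      · exact absurd rfl hcd
      · exact (hfar d hd').le
      · rw [norm_sub_rev]; exact (hfar c hc').le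
      · exact hs.2 c hc' d hd' hcd
  have := le_csSup hbdd (show (insert x s).card ∈ C from ⟨_, hQ, rfl⟩)
  rw [card_insert_of_notMem hxs] at this
  omega

end Nets

section Projections

open WithLp InnerProductSpace

variable {ι : Type*} [Fintype ι]

lemma star_dotProduct_eq_inner (v w : ι → ℂ) :
    star v ⬝ᵥ w = inner ℂ (toLp 2 v) (toLp 2 w) := by
  rw [EuclideanSpace.inner_eq_star_dotProduct, dotProduct_comm]

lemma IsStarProjection.star_mulVec_dotProduct {N : Matrix ι ι ℂ} (hN : IsStarProjection N)
    (v w : ι → ℂ) : star (N *ᵥ v) ⬝ᵥ w = star v ⬝ᵥ N *ᵥ w := by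
  have h : Nᴴ = N := hN.isSelfAdjoint
  rw [star_mulVec, h, ← dotProduct_mulVec]

lemma IsStarProjection.mulVec_mulVec_self {N : Matrix ι ι ℂ} (hN : IsStarProjection N)
    (v : ι → ℂ) : N *ᵥ (N *ᵥ v) = N *ᵥ v := by
  rw [mulVec_mulVec, hN.isIdempotentElem.eq]

lemma IsStarProjection.re_dotProduct_mulVec {N : Matrix ι ι ℂ} (hN : IsStarProjection N)
    (v : ι → ℂ) : (star v ⬝ᵥ N *ᵥ v).re = ‖toLp 2 (N *ᵥ v)‖ ^ 2 := by
  rw [← hN.mulVec_mulVec_self, ← hN.star_mulVec_dotProduct, star_dotProduct_eq_inner,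
    inner_self_eq_norm_sq_to_K, hN.mulVec_mulVec_self]
  norm_cast

lemma IsStarProjection.norm_mulVec_le {N : Matrix ι ι ℂ} (hN : IsStarProjection N)
    (v : ι → ℂ) : ‖toLp 2 (N *ᵥ v)‖ ≤ ‖toLp 2 v‖ := by
  have h := hN.re_dotProduct_mulVec v
  rw [star_dotProduct_eq_inner] at h
  have h2 := re_inner_le_norm (𝕜 := ℂ) (toLp 2 v) (toLp 2 (N *ᵥ v))
  simp only [RCLike.re_to_complex] at h2
  rw [h, pow_two] at h2
  by_contra! h3
  nlinarith [norm_nonneg (toLp 2 v)]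

lemma norm_sq_add_norm_sq_le {P Q : Matrix ι ι ℂ} (hP : IsStarProjection P)
    (hQ : IsStarProjection Q) (hPQ : P * Q * P = (1 / 4 : ℂ) • P) (v : ι → ℂ) :
    ‖toLp 2 (P *ᵥ v)‖ ^ 2 + ‖toLp 2 (Q *ᵥ v)‖ ^ 2 ≤ 3 / 2 * ‖toLp 2 v‖ ^ 2 := by
  set a := toLp 2 (P *ᵥ v)
  set b := toLp 2 (Q *ᵥ v)
  set c := toLp 2 (Q *ᵥ (P *ᵥ v))
  have hc : ‖c‖ ^ 2 = 1 / 4 * ‖a‖ ^ 2 := by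
    rw [← hQ.re_dotProduct_mulVec, ← hP.re_dotProduct_mulVec, hP.star_mulVec_dotProduct,
      mulVec_mulVec, mulVec_mulVec, hPQ, smul_mulVec, dotProduct_smul]
    simp
  have hc' : ‖c‖ = 1 / 2 * ‖a‖ := by
    rw [← sq_eq_sq₀ (norm_nonneg _) (by positivity), hc]; ring
  have hab : (inner ℂ a b).re ≤ 1 / 2 * ‖a‖ * ‖b‖ := by
    have : inner ℂ a b = inner ℂ c b := by
      rw [← star_dotProduct_eq_inner, ← star_dotProduct_eq_inner, hQ.star_mulVec_dotProduct,
        hQ.mulVec_mulVec_self]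
    rw [this, ← hc']
    exact re_inner_le_norm (𝕜 := ℂ) c b
  have hva : (inner ℂ (toLp 2 v) a).re = ‖a‖ ^ 2 := by
    rw [← star_dotProduct_eq_inner, hP.re_dotProduct_mulVec]
  have hvb : (inner ℂ (toLp 2 v) b).re = ‖b‖ ^ 2 := by
    rw [← star_dotProduct_eq_inner, hQ.re_dotProduct_mulVec]
  have h1 : ‖a‖ ^ 2 + ‖b‖ ^ 2 ≤ ‖toLp 2 v‖ * ‖a + b‖ := by
    have := re_inner_le_norm (𝕜 := ℂ) (toLp 2 v) (a + b)
    rw [inner_add_right] at this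
    simp only [RCLike.re_to_complex, Complex.add_re, hva, hvb] at this
    exact this
  have h2 : ‖a + b‖ ^ 2 ≤ 3 / 2 * (‖a‖ ^ 2 + ‖b‖ ^ 2) := by
    have := norm_add_sq (𝕜 := ℂ) a b
    simp only [RCLike.re_to_complex] at this
    nlinarith [sq_nonneg (‖a‖ - ‖b‖)]
  set s := ‖a‖ ^ 2 + ‖b‖ ^ 2
  have hs : 0 ≤ s := by positivity
  have h3 : s ^ 2 ≤ ‖toLp 2 v‖ ^ 2 * (3 / 2 * s) :=
    calc s ^ 2 ≤ (‖toLp 2 v‖ * ‖a + b‖) ^ 2 := by gcongr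
      _ = ‖toLp 2 v‖ ^ 2 * ‖a + b‖ ^ 2 := by ring
      _ ≤ _ := by gcongr
  rcases hs.eq_or_lt with h0 | h0
  · rw [← h0]; positivity
  · refine le_of_mul_le_mul_right ?_ h0
    linarith

lemma IsStarProjection.norm_sq_le_add {N : Matrix ι ι ℂ} (hN : IsStarProjection N)
    {v w : ι → ℂ} {η : ℝ} (hv : ‖toLp 2 v‖ ≤ 1) (hw : ‖toLp 2 w‖ ≤ 1)
    (hvw : ‖toLp 2 v - toLp 2 w‖ ≤ η) :
    ‖toLp 2 (N *ᵥ v)‖ ^ 2 ≤ ‖toLp 2 (N *ᵥ w)‖ ^ 2 + 2 * η := by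
  have h1 := hN.norm_mulVec_le v
  have h2 := hN.norm_mulVec_le w
  have h3 := hN.norm_mulVec_le (v - w)
  rw [mulVec_sub, toLp_sub, toLp_sub] at h3
  have h4 := norm_sub_norm_le (toLp 2 (N *ᵥ v)) (toLp 2 (N *ᵥ w))
  have h5 := norm_nonneg (toLp 2 (N *ᵥ v))
  have h6 := norm_nonneg (toLp 2 (N *ᵥ w))
  have h7 : ‖toLp 2 (N *ᵥ v)‖ - ‖toLp 2 (N *ᵥ w)‖ ≤ η := by linarith
  have h8 : 0 ≤ η := (norm_nonneg _).trans hvw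
  nlinarith [mul_le_mul_of_nonneg_right h7 (add_nonneg h5 h6)]

lemma IsStarProjection.conj_unitary [DecidableEq ι] {N U : Matrix ι ι ℂ} (hN : IsStarProjection N)
    (hU : U ∈ unitaryGroup ι ℂ) : IsStarProjection (star U * N * U) where
  isIdempotentElem := by
    have h := hN.isIdempotentElem.eq
    have hu := mem_unitaryGroup_iff.1 hU
    calc star U * N * U * (star U * N * U) = star U * N * (U * star U) * N * U := by
          simp only [mul_assoc]
      _ = star U * (N * N) * U := by rw [hu]; simp only [mul_assoc, one_mul]
      _ = _ := by rw [h]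
  isSelfAdjoint := by
    have h : star N = N := hN.isSelfAdjoint
    simp [IsSelfAdjoint, star_mul, h, mul_assoc]

end Projections

section Routing

variable {EA EB : Type*} [DecidableEq EA] [DecidableEq EB]

lemma Nbit_false_apply (p q : Bool × Bool) :
    Nbit false p q = if p.1 = p.2 ∧ q.1 = q.2 then 1 / 2 else 0 := by
  have h : (Real.sqrt 2 : ℂ) * Real.sqrt 2 = 2 := by
    norm_cast
    exact Real.mul_self_sqrt (by norm_num)
  simp only [Nbit, projPhiPlus, vecMulVec_apply, phiPlus, Pi.star_apply, Bool.false_eq_true,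
    if_false]
  by_cases h1 : p.1 = p.2 <;> by_cases h2 : q.1 = q.2 <;> simp [h1, h2]
  rw [← mul_inv, h]

lemma bits_one_eq_iff {a b : Bits 1} : a = b ↔ a 0 = b 0 :=
  ⟨fun h => by rw [h], fun h => funext fun i => by rwa [Subsingleton.elim i 0]⟩

/-- The test projector `N^z` for a single output qubit. -/
abbrev routProj (EA EB : Type*) [DecidableEq EA] [DecidableEq EB] (z : Bool) :
    Matrix (Bits 1 × (Bits 1 × EA) × (Bits 1 × EB)) (Bits 1 × (Bits 1 × EA) × (Bits 1 × EB)) ℂ :=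
  Nmat 1 (fun _ => z) (fun _ => false)

lemma routProj_false_apply (r c : Bits 1 × (Bits 1 × EA) × (Bits 1 × EB)) :
    routProj EA EB false r c =
      if r.1 = r.2.1.1 ∧ c.1 = c.2.1.1 ∧ r.2.1.2 = c.2.1.2 ∧ r.2.2 = c.2.2 then 1 / 2 else 0 := by
  obtain ⟨v, ⟨a, e⟩, b, g⟩ := r
  obtain ⟨v', ⟨a', e'⟩, b', g'⟩ := c
  simp only [routProj, Nmat, Fin.prod_univ_one, Nbit_false_apply, Bool.false_eq_true, if_false,
    Prod.mk.injEq, bits_one_eq_iff]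
  split_ifs <;> simp_all

lemma routProj_true_apply (r c : Bits 1 × (Bits 1 × EA) × (Bits 1 × EB)) :
    routProj EA EB true r c =
      if r.1 = r.2.2.1 ∧ c.1 = c.2.2.1 ∧ r.2.2.2 = c.2.2.2 ∧ r.2.1 = c.2.1 then 1 / 2 else 0 := by
  obtain ⟨v, ⟨a, e⟩, b, g⟩ := r
  obtain ⟨v', ⟨a', e'⟩, b', g'⟩ := c
  simp only [routProj, Nmat, Fin.prod_univ_one, Nbit_false_apply, if_true,
    Prod.mk.injEq, bits_one_eq_iff]
  split_ifs <;> simp_all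

variable [Fintype EA] [Fintype EB]

lemma routProj_false_mulVec (u : Bits 1 × (Bits 1 × EA) × (Bits 1 × EB) → ℂ)
    (v a : Bits 1) (e : EA) (β : Bits 1 × EB) :
    (routProj EA EB false *ᵥ u) (v, (a, e), β) =
      if v = a then 1 / 2 * ∑ w, u (w, (w, e), β) else 0 := by
  simp only [mulVec, dotProduct, routProj_false_apply, Fintype.sum_prod_type]
  by_cases h : v = a
  · simp [h, ite_and, mul_sum, Prod.ext_iff]
  · simp [h]

lemma routProj_true_mulVec (u : Bits 1 × (Bits 1 × EA) × (Bits 1 × EB) → ℂ)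
    (v b : Bits 1) (α : Bits 1 × EA) (g : EB) :
    (routProj EA EB true *ᵥ u) (v, α, (b, g)) =
      if v = b then 1 / 2 * ∑ w, u (w, α, (w, g)) else 0 := by
  simp only [mulVec, dotProduct, routProj_true_apply, Fintype.sum_prod_type]
  by_cases h : v = b
  · simp [h, ite_and, mul_sum, Prod.ext_iff]
  · simp [h]

lemma matrix_ext_mulVec {ι : Type*} [Fintype ι] [DecidableEq ι] {M N : Matrix ι ι ℂ}
    (h : ∀ u, M *ᵥ u = N *ᵥ u) : M = N :=
  toLin'.injective (LinearMap.ext h)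

lemma isStarProjection_routProj (z : Bool) : IsStarProjection (routProj EA EB z) := by
  constructor
  · refine matrix_ext_mulVec fun u => ?_
    ext ⟨v, ⟨a, e⟩, ⟨b, g⟩⟩
    rw [← mulVec_mulVec]
    cases z <;> simp [routProj_false_mulVec, routProj_true_mulVec]
  · ext r c
    rw [star_apply]
    cases z
    · rw [routProj_false_apply, routProj_false_apply]
      split_ifs <;> simp_all
    · rw [routProj_true_apply, routProj_true_apply]
      split_ifs <;> simp_all

lemma routProj_false_mul_true_mul_false :
    routProj EA EB false * routProj EA EB true * routProj EA EB false =
      (1 / 4 : ℂ) • routProj EA EB false := by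
  refine matrix_ext_mulVec fun u => ?_
  ext ⟨v, ⟨a, e⟩, ⟨b, g⟩⟩
  rw [← mulVec_mulVec, ← mulVec_mulVec, smul_mulVec]
  simp only [Pi.smul_apply, routProj_false_mulVec, routProj_true_mulVec, mul_ite, mul_zero,
    Finset.sum_ite_eq', mem_univ, if_true, smul_eq_mul]
  split_ifs
  · ring
  · rfl

/-- `I ⊗ K ⊗ L` acting on three tensor factors. -/
abbrev tri {V A B : Type*} [DecidableEq V] (K : Matrix A A ℂ) (L : Matrix B B ℂ) :
    Matrix (V × A × B) (V × A × B) ℂ :=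
  (1 : Matrix V V ℂ) ⊗ₖ (K ⊗ₖ L)

section tri

variable {V A B : Type*} [DecidableEq V]

lemma star_tri (K : Matrix A A ℂ) (L : Matrix B B ℂ) :
    star (tri (V := V) K L) = tri (star K) (star L) := by
  simp only [tri, star_eq_conjTranspose, conjTranspose_kronecker, conjTranspose_one]

variable [Fintype V] [Fintype A] [Fintype B]

lemma tri_mul_tri (K K' : Matrix A A ℂ) (L L' : Matrix B B ℂ) :
    tri (V := V) K L * tri K' L' = tri (K * K') (L * L') := by
  rw [tri, tri, ← mul_kronecker_mul, ← mul_kronecker_mul, one_mul]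

lemma tri_mulVec_apply (K : Matrix A A ℂ) (L : Matrix B B ℂ) (u : V × A × B → ℂ)
    (v : V) (a : A) (b : B) :
    (tri K L *ᵥ u) (v, a, b) = ∑ a', ∑ b', K a a' * L b b' * u (v, a', b') := by
  simp only [mulVec, dotProduct, Fintype.sum_prod_type, kronecker_apply, one_apply, ite_mul,
    one_mul, zero_mul]
  rw [Finset.sum_eq_single v (fun w _ hw => by simp [hw.symm]) (by simp)]
  simp

variable [DecidableEq A] [DecidableEq B]

lemma tri_mem_unitaryGroup {K : Matrix A A ℂ} {L : Matrix B B ℂ}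
    (hK : K ∈ unitaryGroup A ℂ) (hL : L ∈ unitaryGroup B ℂ) :
    tri (V := V) K L ∈ unitaryGroup (V × A × B) ℂ := by
  rw [mem_unitaryGroup_iff, star_tri, tri_mul_tri, mem_unitaryGroup_iff.1 hK,
    mem_unitaryGroup_iff.1 hL, tri, one_kronecker_one, one_kronecker_one]

end tri

lemma routProj_false_mul_tri (L : Matrix (Bits 1 × EB) (Bits 1 × EB) ℂ) :
    routProj EA EB false * tri 1 L = tri 1 L * routProj EA EB false := by
  refine matrix_ext_mulVec fun u => ?_
  ext ⟨v, ⟨a, e⟩, β⟩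
  rw [← mulVec_mulVec, ← mulVec_mulVec]
  simp only [routProj_false_mulVec, tri_mulVec_apply, one_apply, ite_mul, one_mul, zero_mul]
  simp_rw [Finset.sum_comm (s := (univ : Finset (Bits 1 × EA))), Finset.sum_ite_eq]
  simp only [mem_univ, if_true, routProj_false_mulVec]
  split_ifs
  · rw [Finset.sum_comm, mul_sum]
    refine sum_congr rfl fun β' _ => ?_
    rw [← mul_sum]; ring
  · simp

lemma routProj_true_mul_tri (K : Matrix (Bits 1 × EA) (Bits 1 × EA) ℂ) :
    routProj EA EB true * tri K 1 = tri K 1 * routProj EA EB true := by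
  refine matrix_ext_mulVec fun u => ?_
  ext ⟨v, α, ⟨b, g⟩⟩
  rw [← mulVec_mulVec, ← mulVec_mulVec]
  simp only [routProj_true_mulVec, tri_mulVec_apply, one_apply, mul_ite, mul_one, mul_zero,
    ite_mul, zero_mul, Finset.sum_ite_eq, mem_univ, if_true]
  split_ifs
  · rw [Finset.sum_comm, mul_sum]
    refine sum_congr rfl fun β' _ => ?_
    rw [← mul_sum]; ring
  · simp

/-- The pulled-back test projector `(I ⊗ K ⊗ L)† N^z (I ⊗ K ⊗ L)`. -/
abbrev pullProj (z : Bool) (K : Matrix (Bits 1 × EA) (Bits 1 × EA) ℂ)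
    (L : Matrix (Bits 1 × EB) (Bits 1 × EB) ℂ) :=
  star (tri (V := Bits 1) K L) * routProj EA EB z * tri K L

lemma isStarProjection_pullProj (z : Bool) {K : Matrix (Bits 1 × EA) (Bits 1 × EA) ℂ}
    {L : Matrix (Bits 1 × EB) (Bits 1 × EB) ℂ} (hK : K ∈ unitaryGroup (Bits 1 × EA) ℂ)
    (hL : L ∈ unitaryGroup (Bits 1 × EB) ℂ) : IsStarProjection (pullProj z K L) :=
  (isStarProjection_routProj z).conj_unitary (tri_mem_unitaryGroup hK hL)

lemma pullProj_mul_pullProj_mul_pullProj {K K' : Matrix (Bits 1 × EA) (Bits 1 × EA) ℂ}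
    {L L' : Matrix (Bits 1 × EB) (Bits 1 × EB) ℂ}
    (hK : K ∈ unitaryGroup (Bits 1 × EA) ℂ) (hK' : K' ∈ unitaryGroup (Bits 1 × EA) ℂ)
    (hL : L ∈ unitaryGroup (Bits 1 × EB) ℂ) (hL' : L' ∈ unitaryGroup (Bits 1 × EB) ℂ) :
    pullProj false K L * pullProj true K' L' * pullProj false K L =
      (1 / 4 : ℂ) • pullProj false K L := by
  have hK2 : K * star K' ∈ unitaryGroup (Bits 1 × EA) ℂ := mul_mem hK (Unitary.star_mem hK')
  have hL2 : L * star L' ∈ unitaryGroup (Bits 1 × EB) ℂ := mul_mem hL (Unitary.star_mem hL')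
  set M := tri (V := Bits 1) K L
  set M' := tri (V := Bits 1) K' L'
  set P := routProj EA EB false
  set Q := routProj EA EB true
  set X := tri (V := Bits 1) (K * star K') (1 : Matrix (Bits 1 × EB) (Bits 1 × EB) ℂ)
  set Y := tri (V := Bits 1) (1 : Matrix (Bits 1 × EA) (Bits 1 × EA) ℂ) (L * star L')
  have hX : X * star X = 1 := mem_unitaryGroup_iff.1 (tri_mem_unitaryGroup hK2 (one_mem _))
  have hY : Y * star Y = 1 := mem_unitaryGroup_iff.1 (tri_mem_unitaryGroup (one_mem _) hL2)
  have hW : M * star M' = Y * X := by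
    simp only [M, M', X, Y, star_tri, tri_mul_tri, one_mul, mul_one]
  have hW' : M' * star M = star X * star Y := by
    rw [← star_mul, ← hW, star_mul, star_star]
  have hPY : P * Y = Y * P := routProj_false_mul_tri _
  have hQX : Q * X = X * Q := routProj_true_mul_tri _
  have hPY' : star Y * P = P * star Y := by
    have h : star P = P := (isStarProjection_routProj false).isSelfAdjoint
    rw [← h, ← star_mul, h, hPY, star_mul, h]
  have hPQP : P * Q * P = (1 / 4 : ℂ) • P := routProj_false_mul_true_mul_false
  calc star M * P * M * (star M' * Q * M') * (star M * P * M)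
      = star M * (P * (M * star M') * Q * (M' * star M) * P) * M := by simp only [mul_assoc]
    _ = star M * (P * Y * X * Q * star X * (star Y * P)) * M := by
        rw [hW, hW']; simp only [mul_assoc]
    _ = star M * (Y * (P * Q * (X * star X) * P) * star Y) * M := by
        rw [hPY, hPY', mul_assoc (Y * P) X Q, ← hQX]; simp only [mul_assoc]
    _ = (1 / 4 : ℂ) • (star M * (P * (Y * star Y)) * M) := by
        rw [hX, mul_one, hPQP]
        simp only [mul_smul_comm, smul_mul_assoc]
        rw [← hPY]; simp only [mul_assoc]
    _ = (1 / 4 : ℂ) • (star M * P * M) := by rw [hY, mul_one]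

open WithLp in
/-- For a fixed state, the optimal success probabilities of the two tests add up to at most
`3 / 2`. -/
lemma exists_optimal_bound (u : Bits 1 × (Bits 1 × EA) × (Bits 1 × EB) → ℂ)
    (hu : ‖toLp 2 u‖ ≤ 1) :
    ∃ g : Bits 1 → ℝ, (∀ b, g b ∈ Set.Icc (0 : ℝ) 1) ∧ ∑ b, g b ≤ 2 * (3 / 4) ∧
      ∀ b, ∀ K ∈ unitaryGroup (Bits 1 × EA) ℂ, ∀ L ∈ unitaryGroup (Bits 1 × EB) ℂ,
        ‖toLp 2 (pullProj (b 0) K L *ᵥ u)‖ ^ 2 ≤ g b := by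
  let C : Bool → Set ℝ := fun z => {r | ∃ K ∈ unitaryGroup (Bits 1 × EA) ℂ,
    ∃ L ∈ unitaryGroup (Bits 1 × EB) ℂ, r = ‖toLp 2 (pullProj z K L *ᵥ u)‖ ^ 2}
  have hne : ∀ z, (C z).Nonempty := fun z => ⟨_, 1, one_mem _, 1, one_mem _, rfl⟩
  have hle : ∀ z, ∀ r ∈ C z, r ≤ 1 := by
    rintro z _ ⟨K, hK, L, hL, rfl⟩
    exact pow_le_one₀ (norm_nonneg _) (((isStarProjection_pullProj z hK hL).norm_mulVec_le u).trans hu)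
  have hbdd : ∀ z, BddAbove (C z) := fun z => ⟨1, hle z⟩
  refine ⟨fun b => sSup (C (b 0)), fun b => ⟨?_, csSup_le (hne _) (hle _)⟩, ?_,
    fun b K hK L hL => le_csSup (hbdd _) ⟨K, hK, L, hL, rfl⟩⟩
  · refine Real.sSup_nonneg ?_
    rintro _ ⟨K, hK, L, hL, rfl⟩
    positivity
  · rw [sum_bits_one, ← le_sub_iff_add_le]
    refine csSup_le (hne _) ?_
    rintro _ ⟨K, hK, L, hL, rfl⟩
    rw [le_sub_comm]
    refine csSup_le (hne _) ?_
    rintro _ ⟨K', hK', L', hL', rfl⟩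
    have h := norm_sq_add_norm_sq_le (isStarProjection_pullProj false hK hL)
      (isStarProjection_pullProj true hK' hL')
      (pullProj_mul_pullProj_mul_pullProj hK hK' hL hL') u
    have h2 : ‖toLp 2 u‖ ^ 2 ≤ 1 := pow_le_one₀ (norm_nonneg _) hu
    linarith

end Routing

section Approximation

open WithLp
open scoped Matrix.Norms.L2Operator

section tri

variable {V A B : Type*} [Fintype V] [DecidableEq V] [Fintype A] [DecidableEq A]
  [Fintype B] [DecidableEq B]

lemma norm_tri_mulVec_le_left (K : Matrix A A ℂ) (u : V × A × B → ℂ) :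
    ‖toLp 2 (tri K (1 : Matrix B B ℂ) *ᵥ u)‖ ≤ ‖K‖ * ‖toLp 2 u‖ := by
  refine le_of_sq_le_sq ?_ (by positivity)
  rw [mul_pow, EuclideanSpace.norm_sq_eq, EuclideanSpace.norm_sq_eq]
  simp only [Fintype.sum_prod_type, mul_sum]
  refine sum_le_sum fun v _ => ?_
  rw [sum_comm, sum_comm (s := (univ : Finset A))]
  refine sum_le_sum fun b _ => ?_
  have h := l2_opNorm_mulVec K (toLp 2 fun a => u (v, a, b))
  have h2 := pow_le_pow_left₀ (norm_nonneg _) h 2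
  rw [mul_pow, EuclideanSpace.norm_sq_eq, EuclideanSpace.norm_sq_eq, mul_sum] at h2
  refine le_trans (le_of_eq (sum_congr rfl fun a _ => ?_)) h2
  rw [tri_mulVec_apply]
  simp [one_apply, mulVec, dotProduct]

lemma norm_tri_mulVec_le_right (L : Matrix B B ℂ) (u : V × A × B → ℂ) :
    ‖toLp 2 (tri (1 : Matrix A A ℂ) L *ᵥ u)‖ ≤ ‖L‖ * ‖toLp 2 u‖ := by
  refine le_of_sq_le_sq ?_ (by positivity)
  rw [mul_pow, EuclideanSpace.norm_sq_eq, EuclideanSpace.norm_sq_eq]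
  simp only [Fintype.sum_prod_type, mul_sum]
  refine sum_le_sum fun v _ => sum_le_sum fun a _ => ?_
  have h := l2_opNorm_mulVec L (toLp 2 fun b => u (v, a, b))
  have h2 := pow_le_pow_left₀ (norm_nonneg _) h 2
  rw [mul_pow, EuclideanSpace.norm_sq_eq, EuclideanSpace.norm_sq_eq, mul_sum] at h2
  refine le_trans (le_of_eq (sum_congr rfl fun b _ => ?_)) h2
  rw [tri_mulVec_apply, sum_comm]
  simp [one_apply, mulVec, dotProduct]

lemma norm_tri_mulVec_le (K : Matrix A A ℂ) (L : Matrix B B ℂ) (u : V × A × B → ℂ) :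
    ‖toLp 2 (tri K L *ᵥ u)‖ ≤ ‖K‖ * (‖L‖ * ‖toLp 2 u‖) := by
  have h : tri (V := V) K L = tri K 1 * tri 1 L := by rw [tri_mul_tri, mul_one, one_mul]
  rw [h, ← mulVec_mulVec]
  refine (norm_tri_mulVec_le_left _ _).trans ?_
  gcongr
  exact norm_tri_mulVec_le_right _ _

lemma norm_tri_mulVec_le_one {K : Matrix A A ℂ} {L : Matrix B B ℂ} {u : V × A × B → ℂ}
    (hK : ‖K‖ ≤ 1) (hL : ‖L‖ ≤ 1) (hu : ‖toLp 2 u‖ ≤ 1) :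
    ‖toLp 2 (tri K L *ᵥ u)‖ ≤ 1 :=
  (norm_tri_mulVec_le K L u).trans
    (mul_le_one₀ hK (by positivity) (mul_le_one₀ hL (norm_nonneg _) hu))

lemma norm_tri_mulVec_sub_le {K K' : Matrix A A ℂ} {L L' : Matrix B B ℂ} {u u' : V × A × B → ℂ}
    {η : ℝ} (hK' : ‖K'‖ ≤ 1) (hL : ‖L‖ ≤ 1) (hL' : ‖L'‖ ≤ 1) (hu : ‖toLp 2 u‖ ≤ 1)
    (h1 : ‖K - K'‖ ≤ η) (h2 : ‖L - L'‖ ≤ η) (h3 : ‖toLp 2 u - toLp 2 u'‖ ≤ η) :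
    ‖toLp 2 (tri K L *ᵥ u) - toLp 2 (tri K' L' *ᵥ u')‖ ≤ 3 * η := by
  have hη : 0 ≤ η := (norm_nonneg _).trans h1
  have e : toLp 2 (tri K L *ᵥ u) - toLp 2 (tri K' L' *ᵥ u') =
      toLp 2 (tri (K - K') L *ᵥ u) + toLp 2 (tri K' (L - L') *ᵥ u) +
        toLp 2 (tri K' L' *ᵥ (u - u')) := by
    rw [← toLp_add, ← toLp_add, ← toLp_sub]
    congr 1
    ext ⟨v, a, b⟩
    simp only [Pi.sub_apply, Pi.add_apply, tri_mulVec_apply, Matrix.sub_apply, ← sum_sub_distrib,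
      ← sum_add_distrib]
    refine sum_congr rfl fun _ _ => sum_congr rfl fun _ _ => ?_
    ring
  rw [e]
  have g1 := norm_tri_mulVec_le (K - K') L u
  have g2 := norm_tri_mulVec_le K' (L - L') u
  have g3 := norm_tri_mulVec_le K' L' (u - u')
  rw [toLp_sub] at g3
  have f1 : ‖K - K'‖ * (‖L‖ * ‖toLp 2 u‖) ≤ η * (1 * 1) := by gcongr
  have f2 : ‖K'‖ * (‖L - L'‖ * ‖toLp 2 u‖) ≤ 1 * (η * 1) := by gcongr
  have f3 : ‖K'‖ * (‖L'‖ * ‖toLp 2 u - toLp 2 u'‖) ≤ 1 * (1 * η) := by gcongr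
  refine (norm_add₃_le).trans ?_
  linarith

end tri

lemma norm_toLp_comp_equiv {ι κ : Type*} [Fintype ι] [Fintype κ] (σ : ι ≃ κ) (w : κ → ℂ) :
    ‖toLp 2 (w ∘ σ)‖ = ‖toLp 2 w‖ := by
  rw [EuclideanSpace.norm_eq, EuclideanSpace.norm_eq]
  congr 1
  exact σ.sum_comp (fun i => ‖w i‖ ^ 2)

lemma norm_le_one_of_mem_unitaryGroup {ι : Type*} [Fintype ι] [DecidableEq ι]
    {U : Matrix ι ι ℂ} (hU : U ∈ unitaryGroup ι ℂ) : ‖U‖ ≤ 1 := by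
  cases subsingleton_or_nontrivial (Matrix ι ι ℂ)
  · rw [Subsingleton.elim U 0, norm_zero]
    exact zero_le_one
  · exact (CStarRing.norm_of_mem_unitary hU).le

/-- The regrouping `V ⊗ A' ⊗ B' ≅ V ⊗ A ⊗ B` of tensor factors. -/
def regroup {W Ak Ac Bk Bc A' B' : Type*} (eA : A' ≃ Ak × Bc) (eB : B' ≃ Bk × Ac) :
    W × A' × B' ≃ W × (Ak × Ac) × (Bk × Bc) :=
  (Equiv.refl W).prodCongr ((eA.prodCongr eB).trans
    { toFun := fun p => ((p.1.1, p.2.2), (p.2.1, p.1.2))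
      invFun := fun p => ((p.1.1, p.2.2), (p.2.1, p.1.2))
      left_inv := fun _ => rfl
      right_inv := fun _ => rfl })

/-- A finite family of success-probability profiles dominating, up to `6 * η`, every choice of
shared state and local isometries of given dimensions. -/
lemma exists_profile_family {X Y Ak Ac Bk Bc EA EB : Type*} [Fintype X] [Fintype Y]
    [Fintype Ak] [Fintype Ac] [Fintype Bk] [Fintype Bc] [Fintype EA] [Fintype EB]
    [DecidableEq Ak] [DecidableEq Ac] [DecidableEq Bk] [DecidableEq Bc]
    [DecidableEq EA] [DecidableEq EB]
    (eA : Bits 1 × EA ≃ Ak × Bc) (eB : Bits 1 × EB ≃ Bk × Ac) {η : ℝ} (hη : 0 < η) :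
    ∃ S : Finset (X × Y → Bits 1 → ℝ),
      (S.card : ℝ) ≤
        ((1 + 2 / η) ^ (2 * Fintype.card (Ak × Ac) ^ 2)) ^ Fintype.card X *
        ((1 + 2 / η) ^ (2 * Fintype.card (Bk × Bc) ^ 2)) ^ Fintype.card Y *
        (1 + 2 / η) ^ (2 * (2 * (Fintype.card (Ak × Ac) * Fintype.card (Bk × Bc)))) ∧
      (∀ g ∈ S, (∀ p b, g p b ∈ Set.Icc (0 : ℝ) 1) ∧ ∀ p, ∑ b, g p b ≤ 2 * (3 / 4)) ∧
      ∀ (φ : Bits 1 × (Ak × Ac) × (Bk × Bc) → ℂ)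
        (U : X → Matrix (Ak × Ac) (Ak × Ac) ℂ) (V : Y → Matrix (Bk × Bc) (Bk × Bc) ℂ),
        ‖toLp 2 φ‖ ≤ 1 → (∀ x, U x ∈ unitaryGroup (Ak × Ac) ℂ) →
        (∀ y, V y ∈ unitaryGroup (Bk × Bc) ℂ) →
        ∃ g ∈ S, ∀ x y b, ∀ K ∈ unitaryGroup (Bits 1 × EA) ℂ,
          ∀ L ∈ unitaryGroup (Bits 1 × EB) ℂ,
          ‖toLp 2 (pullProj (b 0) K L *ᵥ ((tri (U x) (V y) *ᵥ φ) ∘ regroup eA eB))‖ ^ 2 ≤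
            g (x, y) b + 6 * η := by
  classical
  obtain ⟨SA, cardA, normA, netA⟩ := exists_net (Matrix (Ak × Ac) (Ak × Ac) ℂ) hη
  obtain ⟨SB, cardB, normB, netB⟩ := exists_net (Matrix (Bk × Bc) (Bk × Bc) ℂ) hη
  obtain ⟨Sφ, cardφ, normφ, netφ⟩ :=
    exists_net (EuclideanSpace ℂ (Bits 1 × (Ak × Ac) × (Bk × Bc))) hη
  have hst : ∀ (i : (X → SA) × (Y → SB) × Sφ) (p : X × Y),
      ‖toLp 2 ((tri (i.1 p.1).1 (i.2.1 p.2).1 *ᵥ ofLp i.2.2.1) ∘ regroup eA eB)‖ ≤ 1 := by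
    intro i p
    rw [norm_toLp_comp_equiv]
    exact norm_tri_mulVec_le_one (normA _ (i.1 p.1).2) (normB _ (i.2.1 p.2).2) (normφ _ i.2.2.2)
  choose G hG01 hGsum hG using fun i p => exists_optimal_bound _ (hst i p)
  refine ⟨univ.image G, ?_, ?_, ?_⟩
  · have h1 : ((univ.image G).card : ℝ) ≤
        (SA.card : ℝ) ^ Fintype.card X * (SB.card : ℝ) ^ Fintype.card Y * Sφ.card := by
      have : (univ.image G).card ≤ _ := card_image_le
      rw [card_univ, Fintype.card_prod, Fintype.card_prod, Fintype.card_fun, Fintype.card_fun,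
        Fintype.card_coe, Fintype.card_coe, Fintype.card_coe, ← mul_assoc] at this
      exact_mod_cast this
    rw [finrank_real_of_complex, Module.finrank_matrix, Module.finrank_self, mul_one,
      ← pow_two] at cardA cardB
    rw [finrank_real_of_complex, finrank_euclideanSpace, Fintype.card_prod,
      Fintype.card_prod (Ak × Ac)] at cardφ
    have h2 : Fintype.card (Bits 1) = 2 := by simp [Bits]
    rw [h2] at cardφ
    refine h1.trans ?_
    gcongr
  · intro g hg
    obtain ⟨i, -, rfl⟩ := mem_image.1 hg
    exact ⟨hG01 i, hGsum i⟩
  · intro φ U V hφ hU hV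
    choose fA hfA hfA' using fun x => netA (U x) (norm_le_one_of_mem_unitaryGroup (hU x))
    choose fB hfB hfB' using fun y => netB (V y) (norm_le_one_of_mem_unitaryGroup (hV y))
    obtain ⟨φ', hφ1, hφ2⟩ := netφ (toLp 2 φ) hφ
    let i : (X → SA) × (Y → SB) × Sφ := (fun x => ⟨fA x, hfA x⟩, fun y => ⟨fB y, hfB y⟩, ⟨φ', hφ1⟩)
    refine ⟨G i, mem_image_of_mem _ (mem_univ _), fun x y b K hK L hL => ?_⟩
    have hdist : ‖toLp 2 ((tri (U x) (V y) *ᵥ φ) ∘ regroup eA eB) -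
        toLp 2 ((tri (fA x) (fB y) *ᵥ ofLp φ') ∘ regroup eA eB)‖ ≤ 3 * η := by
      rw [← toLp_sub]
      have : ((tri (U x) (V y) *ᵥ φ) ∘ regroup eA eB) -
          ((tri (fA x) (fB y) *ᵥ ofLp φ') ∘ regroup eA eB) =
          ((tri (U x) (V y) *ᵥ φ) - (tri (fA x) (fB y) *ᵥ ofLp φ')) ∘ regroup eA eB := rfl
      rw [this, norm_toLp_comp_equiv, toLp_sub]
      exact norm_tri_mulVec_sub_le (normA _ (hfA x)) (norm_le_one_of_mem_unitaryGroup (hV y))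
        (normB _ (hfB y)) hφ (hfA' x) (hfB' y) hφ2
    have hn : ‖toLp 2 ((tri (U x) (V y) *ᵥ φ) ∘ regroup eA eB)‖ ≤ 1 := by
      rw [norm_toLp_comp_equiv]
      exact norm_tri_mulVec_le_one (norm_le_one_of_mem_unitaryGroup (hU x))
        (norm_le_one_of_mem_unitaryGroup (hV y)) hφ
    have h := (isStarProjection_pullProj (b 0) hK hL).norm_sq_le_add hn (hst i (x, y)) hdist
    have h' := hG i (x, y) b K hK L hL
    linarith

end Approximation

section Strategies

open WithLp

/-- Regrouping of qubits: concatenate two registers and split them at another position. -/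
def regroupBits {m r p s : ℕ} (h : p + s = m + r) : Bits m × Bits r ≃ Bits p × Bits s :=
  Equiv.ofBijective (fun w => splitBits (castBits h.symm (Fin.append w.1 w.2))) <| by
    refine (Fintype.bijective_iff_injective_and_card _).2 ⟨fun w w' hw => ?_, ?_⟩
    · have h1 : castBits h.symm (Fin.append w.1 w.2) = castBits h.symm (Fin.append w'.1 w'.2) := by
        funext i
        refine Fin.addCases (fun j => ?_) (fun j => ?_) i
        · exact congrFun (congrArg Prod.fst hw) j
        · exact congrFun (congrArg Prod.snd hw) j
      have h2 : Fin.append w.1 w.2 = Fin.append w'.1 w'.2 := by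
        funext i
        exact congrFun h1 (Fin.cast h.symm i)
      refine Prod.ext (funext fun j => ?_) (funext fun j => ?_)
      · simpa using congrFun h2 (Fin.castAdd r j)
      · simpa using congrFun h2 (Fin.natAdd m j)
    · simp [Bits, ← pow_add, h]

lemma submatrix_mem_unitaryGroup {ι κ : Type*} [Fintype ι] [DecidableEq ι] [Fintype κ]
    [DecidableEq κ] (e : κ ≃ ι) {U : Matrix ι ι ℂ} (hU : U ∈ unitaryGroup ι ℂ) :
    U.submatrix e e ∈ unitaryGroup κ ℂ := by
  rw [mem_unitaryGroup_iff] at hU ⊢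
  rw [star_eq_conjTranspose, conjTranspose_submatrix, submatrix_mul_equiv,
    ← star_eq_conjTranspose, hU, submatrix_one_equiv]

variable {n q : ℕ}

lemma RoutStrategy.Psi_eq (T : RoutStrategy n 1 q) (x y : Bits n) :
    T.Psi x y =
      tri ((T.K x y).submatrix (regroupBits T.hrA) (regroupBits T.hrA))
        ((T.L x y).submatrix (regroupBits T.hrB) (regroupBits T.hrB)) *ᵥ
        ((tri (T.U x) (T.V y) *ᵥ T.φ) ∘ regroup (regroupBits T.hrA) (regroupBits T.hrB)) := by
  ext ⟨v, α, β⟩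
  have h : ∀ w : Bits 1 × (Bits T.qAk × Bits T.qBc) × (Bits T.qBk × Bits T.qAc) → ℂ,
      (tri (T.K x y) (T.L x y) *ᵥ w) (v, regroupBits T.hrA α, regroupBits T.hrB β) =
      (tri ((T.K x y).submatrix (regroupBits T.hrA) (regroupBits T.hrA))
        ((T.L x y).submatrix (regroupBits T.hrB) (regroupBits T.hrB)) *ᵥ
        fun p => w (p.1, regroupBits T.hrA p.2.1, regroupBits T.hrB p.2.2)) (v, α, β) := by
    intro w
    simp only [tri_mulVec_apply, submatrix_apply]
    rw [← (regroupBits T.hrA).sum_comp]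
    refine sum_congr rfl fun a _ => ?_
    rw [← (regroupBits T.hrB).sum_comp]
  exact h _

lemma RoutStrategy.win_eq (T : RoutStrategy n 1 q) (f : Bits n × Bits n → Bits 1) :
    T.win 0 f = (1 / 2 ^ (2 * n) : ℝ) * ∑ x, ∑ y,
      ‖toLp 2 (pullProj (f (x, y) 0)
        ((T.K x y).submatrix (regroupBits T.hrA) (regroupBits T.hrA))
        ((T.L x y).submatrix (regroupBits T.hrB) (regroupBits T.hrB)) *ᵥ
        ((tri (T.U x) (T.V y) *ᵥ T.φ) ∘
          regroup (regroupBits T.hrA) (regroupBits T.hrB)))‖ ^ 2 := by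
  have hfilter : (univ.filter fun a : Bits 1 => (hw a : ℝ) ≤ 0 * ((1 : ℕ) : ℝ)) =
      {fun _ => false} := by
    ext a
    simp only [zero_mul, mem_filter, mem_univ, true_and, mem_singleton, bits_one_eq_iff]
    rw [Nat.cast_nonpos, hw, card_eq_zero, filter_eq_empty_iff]
    simp
  rw [RoutStrategy.win]
  congr 1
  refine sum_congr rfl fun x _ => sum_congr rfl fun y _ => ?_
  rw [hfilter, sum_singleton, T.Psi_eq, ← IsStarProjection.re_dotProduct_mulVec
    (isStarProjection_pullProj _ (submatrix_mem_unitaryGroup _ (T.hK x y))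
      (submatrix_mem_unitaryGroup _ (T.hL x y))), pullProj, ← mulVec_mulVec, ← mulVec_mulVec,
    star_mulVec, ← star_eq_conjTranspose, ← dotProduct_mulVec]
  have hz : (fun _ => f (x, y) 0) = f (x, y) := bits_one_eq_iff.2 rfl
  rw [routProj, hz]

/-- The register sizes of a strategy. -/
def RoutStrategy.sizes (T : RoutStrategy n 1 q) : ℕ × ℕ × ℕ × ℕ × ℕ × ℕ :=
  (T.qAk, T.qAc, T.qBk, T.qBc, T.rA, T.rB)

/-- The finite family of profiles of `exists_profile_family`, for strategies of given register
sizes. -/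
lemma exists_profile_family_of_sizes (n : ℕ) (d : ℕ × ℕ × ℕ × ℕ × ℕ × ℕ) {η : ℝ} (hη : 0 < η) :
    ∃ S : Finset (Bits n × Bits n → Bits 1 → ℝ),
      (∀ q, d.1 + d.2.1 = q → d.2.2.1 + d.2.2.2.1 = q →
        (S.card : ℝ) ≤ (1 + 2 / η) ^ (4 * 4 ^ q * (2 ^ n + 1))) ∧
      (∀ g ∈ S, (∀ p b, g p b ∈ Set.Icc (0 : ℝ) 1) ∧ ∀ p, ∑ b, g p b ≤ 2 * (3 / 4)) ∧
      ∀ (q : ℕ) (T : RoutStrategy n 1 q), T.sizes = d → ∃ g ∈ S, ∀ f,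
        T.win 0 f ≤ (1 / 2 ^ (2 * n) : ℝ) * ∑ p, g p (f p) + 6 * η := by
  by_cases hd : d.1 + d.2.2.2.1 = 1 + d.2.2.2.2.1 ∧ d.2.2.1 + d.2.1 = 1 + d.2.2.2.2.2
  swap
  · refine ⟨∅, fun q _ _ => by simp; positivity, by simp, fun q T hT => ?_⟩
    subst hT
    exact absurd ⟨T.hrA, T.hrB⟩ hd
  obtain ⟨S, hcard, hS, hST⟩ := exists_profile_family (X := Bits n) (Y := Bits n)
    (regroupBits hd.1) (regroupBits hd.2) hη
  refine ⟨S, fun q h1 h2 => hcard.trans (le_of_eq ?_), hS, fun q T hT => ?_⟩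
  · have e1 : Fintype.card (Bits d.1 × Bits d.2.1) = 2 ^ q := by simp [Bits, ← pow_add, h1]
    have e2 : Fintype.card (Bits d.2.2.1 × Bits d.2.2.2.1) = 2 ^ q := by
      simp [Bits, ← pow_add, h2]
    have e3 : Fintype.card (Bits n) = 2 ^ n := by simp [Bits]
    have e4 : (4 : ℕ) ^ q = 2 ^ q * 2 ^ q := by rw [← mul_pow]; norm_num
    rw [e1, e2, e3, ← pow_mul, ← pow_add, ← pow_add, e4]
    congr 1
    ring
  · subst hT
    have hφ : ‖toLp 2 T.φ‖ ≤ 1 := by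
      rw [EuclideanSpace.norm_eq]
      exact le_of_eq (by rw [Real.sqrt_eq_one]; exact T.hφ)
    obtain ⟨g, hg, h⟩ := hST T.φ T.U T.V hφ T.hU T.hV
    refine ⟨g, hg, fun f => ?_⟩
    have e : ∑ x : Bits n, ∑ y : Bits n, (g (x, y) (f (x, y)) + 6 * η) =
        ∑ p, g p (f p) + 2 ^ (2 * n) * (6 * η) := by
      simp only [sum_add_distrib, Fintype.sum_prod_type, sum_const, card_univ]
      congr 1
      simp [Bits, two_mul, pow_add]
      ring
    calc T.win 0 f ≤ (1 / 2 ^ (2 * n) : ℝ) *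
        ∑ x : Bits n, ∑ y : Bits n, (g (x, y) (f (x, y)) + 6 * η) := by
          rw [T.win_eq]
          refine mul_le_mul_of_nonneg_left (sum_le_sum fun x _ => sum_le_sum fun y _ => ?_)
            (by positivity)
          exact h x y _ _ (submatrix_mem_unitaryGroup _ (T.hK x y)) _
            (submatrix_mem_unitaryGroup _ (T.hL x y))
      _ = _ := by
          rw [e, mul_add, ← mul_assoc (1 / 2 ^ (2 * n) : ℝ) (2 ^ (2 * n)), one_div,
            inv_mul_cancel₀ (by positivity), one_mul]

end Strategies

section Soundness

lemma half_card_le_ncard_Fstar (n : ℕ) {ε : ℝ} (hε0 : 0 < ε) (hε : ε ≤ 1 / 4) :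
    (2 : ℝ) ^ 2 ^ (2 * n) / 2 ≤ ((Fstar n 1 ε).ncard : ℝ) := by
  set t : ℝ := Real.sqrt (3 * Real.log (2 / ε)) * (2 : ℝ) ^ (-(n : ℝ) - (1 : ℕ) / 2) with ht
  have hlog : 1 ≤ Real.log (2 / ε) := by
    have h1 : (8 : ℝ) ≤ 2 / ε := by rw [le_div_iff₀ hε0]; linarith
    have h2 := Real.log_le_log (by norm_num) h1
    have h3 : Real.log 8 = 3 * Real.log 2 := by
      rw [show (8 : ℝ) = 2 ^ 3 by norm_num, Real.log_pow]; norm_num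
    linarith [Real.log_two_gt_d9]
  have ht0 : 0 ≤ t := by positivity
  have hcard : Fintype.card (Bits n × Bits n) = 2 ^ (2 * n) := by
    simp [Bits, two_mul, pow_add]
  have ht2 : 3 ≤ 2 * t ^ 2 * (2 : ℝ) ^ (2 * n) := by
    have h1 : ((2 : ℝ) ^ (-(n : ℝ) - (1 : ℕ) / 2)) ^ 2 * (2 : ℝ) ^ (2 * n) = 1 / 2 := by
      rw [← Real.rpow_natCast, ← Real.rpow_mul (by norm_num), ← Real.rpow_natCast 2 (2 * n),
        ← Real.rpow_add (by norm_num),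
        show (-(n : ℝ) - (1 : ℕ) / 2) * (2 : ℕ) + ((2 * n : ℕ) : ℝ) = -1 by push_cast; ring,
        Real.rpow_neg_one]
      norm_num
    rw [ht, mul_pow, Real.sq_sqrt (by linarith), mul_assoc, mul_assoc, h1]
    linarith
  let bad : Bits 1 → Finset (Bits n × Bits n → Bits 1) := fun z => univ.filter fun f =>
    (1 / 2 + t) * Fintype.card (Bits n × Bits n) < ∑ x, if f x = z then (1 : ℝ) else 0
  have hbad : ∀ z, ((bad z).card : ℝ) ≤ 2 ^ 2 ^ (2 * n) * (1 / 4) := by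
    intro z
    have h := card_filter_lt_sum_le (X := Bits n × Bits n) (μ := 1 / 2) ht0
      (fun _ b => if b = z then (1 : ℝ) else 0)
      (fun x b => by split_ifs <;> simp) (fun x => by simp)
    refine h.trans ?_
    rw [hcard]
    gcongr
    push_cast
    rw [Real.exp_neg, one_div]
    refine inv_anti₀ (by norm_num) ?_
    linarith [Real.add_one_le_exp (2 * t ^ 2 * (2 : ℝ) ^ (2 * n))]
  have hqf : ∀ (f : Bits n × Bits n → Bits 1) z, 1 / 2 + t < qf n 1 f z → f ∈ bad z := by
    intro f z h
    rw [qf, lt_div_iff₀ (by positivity)] at h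
    simp only [bad, mem_filter, mem_univ, true_and, hcard, sum_boole]
    exact_mod_cast h
  have hsum : ∀ f : Bits n × Bits n → Bits 1, ∑ z, qf n 1 f z = 1 := by
    intro f
    have h := card_eq_sum_card_fiberwise (f := f) (s := univ) (t := univ) (by simp)
    rw [card_univ, hcard] at h
    simp only [qf, ← sum_div]
    rw [div_eq_one_iff_eq (by positivity)]
    exact_mod_cast h.symm
  have hsub : (Fstar n 1 ε)ᶜ ⊆ ((bad (fun _ => false) ∪ bad (fun _ => true) :
      Finset (Bits n × Bits n → Bits 1)) : Set _) := by
    intro f hf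
    rw [mem_coe, mem_union]
    by_contra hcon
    push Not at hcon
    have h0 := mt (hqf f _) hcon.1
    have h1 := mt (hqf f _) hcon.2
    have h2 := hsum f
    rw [sum_bits_one] at h2
    refine hf fun z => ?_
    have hz : z = (fun _ => false) ∨ z = (fun _ => true) := by
      rw [bits_one_eq_iff, bits_one_eq_iff]
      cases z 0 <;> simp
    rw [← ht, show (2 : ℝ) ^ (-((1 : ℕ) : ℝ)) = 1 / 2 by norm_num [Real.rpow_neg_one], abs_le]
    rcases hz with rfl | rfl <;> constructor <;> linarith
  have h1 := Set.ncard_le_ncard hsub (finite_toSet _)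
  rw [Set.ncard_coe_finset] at h1
  have h2 := Set.ncard_add_ncard_compl (Fstar n 1 ε)
  have h3 : Nat.card (Bits n × Bits n → Bits 1) = 2 ^ 2 ^ (2 * n) := by
    rw [Nat.card_eq_fintype_card, Fintype.card_fun, hcard]
    simp
  have h4 : ((Fstar n 1 ε).ncard : ℝ) + ((Fstar n 1 ε)ᶜ.ncard : ℝ) = 2 ^ 2 ^ (2 * n) := by
    rw [h3] at h2
    exact_mod_cast h2
  have h5 : ((Fstar n 1 ε)ᶜ.ncard : ℝ) ≤
      (bad (fun _ => false)).card + (bad (fun _ => true)).card := by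
    exact_mod_cast h1.trans (card_union_le _ _)
  linarith [hbad (fun _ => false), hbad (fun _ => true)]

lemma target_le (n : ℕ) : (3 / 4 + 22 / 100000 : ℝ) ≤
    (3 / 4 + 1 / 100000 : ℝ) ^ ((999 / 1000 : ℝ)) *
      (1 + 3 * Real.sqrt (6 * Real.log 2) * (2 : ℝ) ^ (-(n : ℝ))) + 21 / 100000 := by
  have h1 : (3 / 4 + 1 / 100000 : ℝ) ≤ (3 / 4 + 1 / 100000 : ℝ) ^ ((999 / 1000 : ℝ)) := by
    conv_lhs => rw [← Real.rpow_one (3 / 4 + 1 / 100000 : ℝ)]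
    exact Real.rpow_le_rpow_of_exponent_ge (by norm_num) (by norm_num) (by norm_num)
  have h2 : (0 : ℝ) ≤ 3 * Real.sqrt (6 * Real.log 2) * (2 : ℝ) ^ (-(n : ℝ)) := by positivity
  nlinarith

lemma qubit_bound {n q : ℕ}
    (hq : (q : ℝ) < (n : ℝ) / 2 + (1 / 2) *
      Real.logb 2
        ((3 / 4 + 1 / 100000 : ℝ) ^ ((999 / 1000 : ℝ)) *
          (1 - (3 / 4 + 1 / 100000 : ℝ) ^ ((1 : ℝ) - 999 / 1000)) *
          Real.logb 2 ((3 / 4 + 1 / 100000) / (3 / 4 : ℝ)) /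
        (8 * Real.logb 2 (1 / (1 / 100000 : ℝ))))) :
    10 ^ 10 * 4 ^ q ≤ 2 ^ n := by
  set a : ℝ := (3 / 4 + 1 / 100000 : ℝ) ^ ((999 / 1000 : ℝ)) with ha
  set b : ℝ := 1 - (3 / 4 + 1 / 100000 : ℝ) ^ ((1 : ℝ) - 999 / 1000) with hb
  set c : ℝ := Real.logb 2 ((3 / 4 + 1 / 100000) / (3 / 4 : ℝ)) with hc
  set d : ℝ := 8 * Real.logb 2 (1 / (1 / 100000 : ℝ)) with hd
  have ha0 : 0 < a := by positivity
  have ha1 : a ≤ 1 := Real.rpow_le_one (by norm_num) (by norm_num) (by norm_num)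
  have hb0 : 0 < b := sub_pos.2 (Real.rpow_lt_one (by norm_num) (by norm_num) (by norm_num))
  have hb1 : b ≤ 34 / 100000 := by
    have h1 : Real.log (1 / (3 / 4 + 1 / 100000)) ≤ 1 / (3 / 4 + 1 / 100000) - 1 :=
      Real.log_le_sub_one_of_pos (by norm_num)
    have h2 := Real.add_one_le_exp (Real.log (3 / 4 + 1 / 100000) * ((1 : ℝ) - 999 / 1000))
    rw [one_div, Real.log_inv] at h1
    rw [hb, Real.rpow_def_of_pos (by norm_num)]
    norm_num at h1 h2 ⊢
    linarith
  have hc0 : 0 < c := Real.logb_pos (by norm_num) (by norm_num)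
  have hc1 : c ≤ 2 / 100000 := by
    have h1 : Real.log ((3 / 4 + 1 / 100000) / (3 / 4)) ≤ (3 / 4 + 1 / 100000) / (3 / 4) - 1 :=
      Real.log_le_sub_one_of_pos (by norm_num)
    rw [hc, Real.logb, div_le_iff₀ (Real.log_pos (by norm_num))]
    norm_num at h1 ⊢
    linarith [Real.log_two_gt_d9]
  have hd1 : 128 ≤ d := by
    have h1 : (16 : ℝ) ≤ Real.logb 2 (1 / (1 / 100000 : ℝ)) := by
      rw [Real.le_logb_iff_rpow_le (by norm_num) (by norm_num)]
      norm_num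
    linarith
  have hκ0 : 0 < a * b * c / d := by positivity
  have hκ1 : a * b * c / d ≤ 1 / 10 ^ 10 := by
    rw [div_le_iff₀ (by linarith)]
    have h1 : a * b * c ≤ 1 * (34 / 100000) * (2 / 100000) := by gcongr
    linarith
  have h1 : ((2 * q : ℕ) : ℝ) - n < Real.logb 2 (a * b * c / d) := by
    push_cast
    linarith
  rw [Real.lt_logb_iff_rpow_lt (by norm_num) hκ0, Real.rpow_sub (by norm_num),
    Real.rpow_natCast, Real.rpow_natCast, div_lt_iff₀ (by positivity), pow_mul] at h1
  have h2 : (10 : ℝ) ^ 10 * 4 ^ q ≤ 2 ^ n := by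
    have h3 : a * b * c / d * 2 ^ n ≤ 1 / 10 ^ 10 * 2 ^ n := by gcongr
    rw [show (2 : ℝ) ^ 2 = 4 by norm_num] at h1
    linarith
  exact_mod_cast h2

lemma union_bound_le {n : ℕ} (hn : 36 ≤ n) :
    (2 : ℝ) ^ (6 * n) * (2 ^ (7200 * 2 ^ n * (2 ^ n + 1) / 10 ^ 12 : ℝ) *
      Real.exp (-(2 * (16 / 100000) ^ 2 * 2 ^ (2 * n)))) ≤ 1 / 2 * (2 : ℝ) ^ (-(2 : ℝ) ^ n) := by
  have hN : (2 : ℝ) ^ 36 ≤ 2 ^ n := pow_le_pow_right₀ (by norm_num) hn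
  have hnN : (n : ℝ) ≤ 2 ^ n := by exact_mod_cast Nat.lt_two_pow_self.le
  have hexp : ∀ x : ℝ, 0 ≤ x → Real.exp (-x) ≤ (2 : ℝ) ^ (-x) := by
    intro x hx
    rw [Real.rpow_def_of_pos (by norm_num)]
    refine Real.exp_le_exp.2 ?_
    nlinarith [Real.log_two_lt_d9]
  refine (mul_le_mul_of_nonneg_left (mul_le_mul_of_nonneg_left (hexp _ (by positivity))
    (by positivity)) (by positivity)).trans ?_
  rw [one_div, ← Real.rpow_neg_one, ← Real.rpow_natCast 2 (6 * n),
    ← Real.rpow_add (by norm_num), ← Real.rpow_add (by norm_num), ← Real.rpow_add (by norm_num)]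
  refine Real.rpow_le_rpow_of_exponent_le (by norm_num) ?_
  rw [mul_comm 2 n, pow_mul (2 : ℝ) n 2]
  push_cast
  generalize (2 : ℝ) ^ n = N at *
  nlinarith

lemma card_profiles_le {n q : ℕ} (hq : 10 ^ 10 * 4 ^ q ≤ 2 ^ n) {x : ℝ}
    (hx : x ≤ (1 + 2 / (1 / 100000 : ℝ)) ^ (4 * 4 ^ q * (2 ^ n + 1))) :
    x ≤ 2 ^ (7200 * 2 ^ n * (2 ^ n + 1) / 10 ^ 12 : ℝ) := by
  have h1 : (1 + 2 / (1 / 100000 : ℝ)) ≤ 2 ^ 18 := by norm_num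
  refine (hx.trans (pow_le_pow_left₀ (by norm_num) h1 _)).trans ?_
  rw [← pow_mul, ← Real.rpow_natCast]
  refine Real.rpow_le_rpow_of_exponent_le (by norm_num) ?_
  have h2 : (10 : ℝ) ^ 10 * 4 ^ q ≤ 2 ^ n := by exact_mod_cast hq
  push_cast
  have h3 := mul_le_mul_of_nonneg_right h2 (by positivity : (0 : ℝ) ≤ 2 ^ n + 1)
  linarith

/-- All but a fraction `2 ^ (-2 ^ n) / 2` of the functions are secure against every strategy on few
qubits. -/
lemma ncard_insecure_le {n : ℕ} (hn : 36 ≤ n) :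
    (({f : Bits n × Bits n → Bits 1 | ∃ q, 10 ^ 10 * 4 ^ q ≤ 2 ^ n ∧ ∃ T : RoutStrategy n 1 q,
      (3 / 4 + 22 / 100000 : ℝ) < T.win 0 f}).ncard : ℝ) ≤
      2 ^ 2 ^ (2 * n) * (1 / 2 * (2 : ℝ) ^ (-(2 : ℝ) ^ n)) := by
  choose S hcard hS hST using fun d => exists_profile_family_of_sizes n d
    (η := 1 / 100000) (by norm_num)
  let R := range (2 * n + 1)
  let D := (R ×ˢ R ×ˢ R ×ˢ R ×ˢ R ×ˢ R).filter fun d =>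
    10 ^ 10 * 4 ^ (d.1 + d.2.1) ≤ 2 ^ n ∧ d.2.2.1 + d.2.2.2.1 = d.1 + d.2.1
  let bad : (Bits n × Bits n → Bits 1 → ℝ) → Finset (Bits n × Bits n → Bits 1) := fun g =>
    univ.filter fun f => (3 / 4 + 16 / 100000) * (2 : ℝ) ^ (2 * n) <
      ∑ p, g p (f p)
  have hN : Fintype.card (Bits n × Bits n) = 2 ^ (2 * n) := by
    simp [Bits, two_mul, pow_add]
  have hsub : {f : Bits n × Bits n → Bits 1 | ∃ q, 10 ^ 10 * 4 ^ q ≤ 2 ^ n ∧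
      ∃ T : RoutStrategy n 1 q, (3 / 4 + 22 / 100000 : ℝ) < T.win 0 f} ⊆
      ((D.biUnion fun d => (S d).biUnion bad : Finset _) : Set _) := by
    rintro f ⟨q, hq, T, hT⟩
    obtain ⟨g, hg, h⟩ := hST T.sizes q T rfl
    have hqn : q ≤ n := by
      have h1 : 2 ^ q ≤ 2 ^ n := by
        have h2 : 2 ^ q ≤ 4 ^ q := Nat.pow_le_pow_left (by norm_num) q
        omega
      exact (Nat.pow_le_pow_iff_right (by norm_num)).1 h1
    have hA := T.hqA
    have hB := T.hqB
    have hrA := T.hrA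
    have hrB := T.hrB
    rw [mem_coe, mem_biUnion]
    refine ⟨T.sizes, ?_, mem_biUnion.2 ⟨g, hg, ?_⟩⟩
    · simp only [D, R, mem_filter, mem_product, mem_range, RoutStrategy.sizes]
      rw [hA]
      refine ⟨?_, hq, hB⟩
      omega
    · have h1 := hT.trans_le (h f)
      have h2 : (3 / 4 + 16 / 100000 : ℝ) < (1 / 2 ^ (2 * n) : ℝ) * ∑ p, g p (f p) := by linarith
      rw [one_div, inv_mul_eq_div, lt_div_iff₀ (by positivity)] at h2
      simp only [bad, mem_filter, mem_univ, true_and]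
      exact h2
  have hbad : ∀ d ∈ D, ∀ g ∈ S d, ((bad g).card : ℝ) ≤ 2 ^ 2 ^ (2 * n) *
      Real.exp (-(2 * (16 / 100000) ^ 2 * 2 ^ (2 * n))) := by
    intro d _ g hg
    have h := card_filter_lt_sum_le (δ := 16 / 100000) (by norm_num) g (hS d g hg).1 (hS d g hg).2
    rw [hN] at h
    push_cast at h
    exact h
  have hD : (D.card : ℝ) ≤ 2 ^ (6 * n) := by
    have h1 : 2 * n + 1 ≤ 2 ^ n := by
      obtain ⟨k, rfl⟩ := Nat.exists_eq_add_of_le' (show 3 ≤ n by omega)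
      have := Nat.lt_two_pow_self (n := k)
      rw [pow_add]
      omega
    have h2 : D.card ≤ (2 * n + 1) ^ 6 := by
      refine (card_filter_le _ _).trans (le_of_eq ?_)
      simp only [card_product, R, card_range]
      ring
    have h3 : (2 * n + 1) ^ 6 ≤ 2 ^ (6 * n) := by
      rw [mul_comm 6 n, pow_mul]
      exact Nat.pow_le_pow_left h1 6
    exact_mod_cast h2.trans h3
  set E : ℝ := 2 ^ (7200 * 2 ^ n * (2 ^ n + 1) / 10 ^ 12 : ℝ) with hE
  set B : ℝ := 2 ^ 2 ^ (2 * n) * Real.exp (-(2 * (16 / 100000) ^ 2 * 2 ^ (2 * n))) with hB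
  have hB0 : 0 ≤ B := by positivity
  have hSE : ∀ d ∈ D, ((S d).card : ℝ) ≤ E := by
    intro d hd
    obtain ⟨-, hq, h2⟩ := mem_filter.1 hd
    exact card_profiles_le hq (hcard d _ rfl h2)
  have hfin := Set.ncard_le_ncard hsub (finite_toSet _)
  rw [Set.ncard_coe_finset] at hfin
  calc _ ≤ ((D.biUnion fun d => (S d).biUnion bad).card : ℝ) := by exact_mod_cast hfin
    _ ≤ ∑ d ∈ D, ∑ g ∈ S d, ((bad g).card : ℝ) := by
      exact_mod_cast card_biUnion_le.trans (sum_le_sum fun d _ => card_biUnion_le)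
    _ ≤ ∑ d ∈ D, ∑ g ∈ S d, B :=
      sum_le_sum fun d hd => sum_le_sum fun g hg => hbad d hd g hg
    _ ≤ ∑ d ∈ D, E * B := sum_le_sum fun d hd => by
      rw [sum_const, nsmul_eq_mul]
      exact mul_le_mul_of_nonneg_right (hSE d hd) hB0
    _ ≤ 2 ^ (6 * n) * (E * B) := by
      rw [sum_const, nsmul_eq_mul]
      gcongr
    _ = 2 ^ 2 ^ (2 * n) * (2 ^ (6 * n) *
        (E * Real.exp (-(2 * (16 / 100000) ^ 2 * 2 ^ (2 * n))))) := by rw [hB]; ring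
    _ ≤ _ := by
      exact mul_le_mul_of_nonneg_left (union_bound_le hn) (by positivity)

end Soundness

/-- single-round soundness `≈ 0.7504` of `QPV_rout^f` (case `m = 1`,
`γ = 0`, `Δ = 10⁻⁵`, `c = 0.999`) against attackers pre-sharing `q < n/2 - O(1)` qubits,
for a uniformly random `f ∈ F*_ε`. -/
theorem stmt15 (n : ℕ) (hn : 36 ≤ n) (ε : ℝ) (hε0 : 0 < ε) (hε : ε ≤ 1 / 4)
    (hregime : Real.sqrt (3 * Real.log (2 / ε)) * (2 : ℝ) ^ (-(n : ℝ) + 1 / 2) < 1 / 4) :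
    (1 - (2 : ℝ) ^ (-(2 : ℝ) ^ ((n : ℝ) -
          (999 / 1000 : ℝ) * Real.logb 2 (1 / (3 / 4 + 1 / 100000))))) *
        ((Fstar n 1 ε).ncard : ℝ) ≤
      (({f ∈ Fstar n 1 ε |
          ∀ q : ℕ,
            (q : ℝ) < (n : ℝ) / 2 + (1 / 2) *
                Real.logb 2
                  ((3 / 4 + 1 / 100000 : ℝ) ^ ((999 / 1000 : ℝ)) *
                    (1 - (3 / 4 + 1 / 100000 : ℝ) ^ ((1 : ℝ) - 999 / 1000)) *
                    Real.logb 2 ((3 / 4 + 1 / 100000) / (3 / 4 : ℝ)) /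
                  (8 * Real.logb 2 (1 / (1 / 100000 : ℝ)))) →
              ∀ T : RoutStrategy n 1 q,
                T.win 0 f ≤
                  (3 / 4 + 1 / 100000 : ℝ) ^ ((999 / 1000 : ℝ)) *
                      (1 + 3 * Real.sqrt (6 * Real.log 2) * (2 : ℝ) ^ (-(n : ℝ))) +
                    21 / 100000}).ncard : ℝ) := by
  set P : Set (Bits n × Bits n → Bits 1) := {f ∈ Fstar n 1 ε | _} with hP
  set I : Set (Bits n × Bits n → Bits 1) := {f | ∃ q, 10 ^ 10 * 4 ^ q ≤ 2 ^ n ∧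
    ∃ T : RoutStrategy n 1 q, (3 / 4 + 22 / 100000 : ℝ) < T.win 0 f} with hI
  have hcover : Fstar n 1 ε ⊆ P ∪ I := by
    intro f hf
    by_cases hfI : f ∈ I
    · exact Or.inr hfI
    · refine Or.inl ⟨hf, fun q hq T => ?_⟩
      refine le_trans ?_ (target_le n)
      by_contra! hlt
      exact hfI ⟨q, qubit_bound hq, T, hlt⟩
  have h1 : ((Fstar n 1 ε).ncard : ℝ) ≤ P.ncard + I.ncard := by
    exact_mod_cast (Set.ncard_le_ncard hcover (Set.toFinite _)).trans (Set.ncard_union_le P I)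
  have h2 : (I.ncard : ℝ) ≤ 2 ^ 2 ^ (2 * n) * (1 / 2 * (2 : ℝ) ^ (-(2 : ℝ) ^ n)) :=
    ncard_insecure_le hn
  have h3 := half_card_le_ncard_Fstar n hε0 hε
  have h4 : (2 : ℝ) ^ (-(2 : ℝ) ^ n) ≤ (2 : ℝ) ^ (-(2 : ℝ) ^ ((n : ℝ) -
      (999 / 1000 : ℝ) * Real.logb 2 (1 / (3 / 4 + 1 / 100000)))) := by
    refine Real.rpow_le_rpow_of_exponent_le (by norm_num) (neg_le_neg ?_)
    rw [← Real.rpow_natCast]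
    refine Real.rpow_le_rpow_of_exponent_le (by norm_num) ?_
    have h5 : 0 ≤ Real.logb 2 (1 / (3 / 4 + 1 / 100000)) :=
      Real.logb_nonneg (by norm_num) (by norm_num)
    linarith
  have h6 := mul_le_mul h4 h3 (by positivity) (by positivity)
  linarith
end
end

section
/- Let N ∈ ℕ and let Π¹, …, Π^N be orthogonal projections on a finite-dimensional complex Hilbert space (i.e. (Πⁱ)* = Πⁱ and (Πⁱ)² = Πⁱ). Let π_1, …, π_N be permutations of {1,…,N} that are mutually orthogonal, i.e. for all k ≠ k' and all i, π_k(i) ≠ π_{k'}(i). Then ‖Σ_{i=1}^N Πⁱ‖ ≤ Σ_{k=1}^N max_{i∈{1,…,N}} ‖Πⁱ · Π^{π_k(i)}‖, where ‖·‖ denotes the operator norm. -/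
open scoped InnerProductSpace in
/-- For self-adjoint idempotents, `⟪P x, Q x⟫` is controlled by `‖P * Q‖`. -/
theorem norm_inner_apply_le_of_isSelfAdjoint_of_mul_self {E : Type*} [NormedAddCommGroup E]
    [InnerProductSpace ℂ E] [CompleteSpace E] {P Q : E →L[ℂ] E} (hP : IsSelfAdjoint P)
    (hPP : P * P = P) (hQQ : Q * Q = Q) (x : E) :
    ‖⟪P x, Q x⟫_ℂ‖ ≤ ‖P * Q‖ * (‖P x‖ * ‖Q x‖) := by
  have hP' : P (P x) = P x := congrArg (· x) hPP
  have hQ' : Q (Q x) = Q x := congrArg (· x) hQQ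
  have h : ⟪P x, Q x⟫_ℂ = ⟪P x, (P * Q) (Q x)⟫_ℂ := by
    rw [mul_apply_eq_comp, hQ', ← ContinuousLinearMap.adjoint_inner_left P,
      hP.adjoint_eq, hP']
  calc ‖⟪P x, Q x⟫_ℂ‖ ≤ ‖P x‖ * ‖(P * Q) (Q x)‖ := h ▸ norm_inner_le_norm _ _
    _ ≤ ‖P x‖ * (‖P * Q‖ * ‖Q x‖) := by gcongr; exact (P * Q).le_opNorm _
    _ = _ := by ring

/-- Along a permutation, `∑ aᵢ a_{σ i} ≤ ∑ aᵢ²`. -/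
theorem sum_mul_comp_perm_le_sum_sq {ι : Type*} [Fintype ι] (a : ι → ℝ) (σ : Equiv.Perm ι) :
    ∑ i, a i * a (σ i) ≤ ∑ i, a i ^ 2 := by
  have h : ∑ i, a (σ i) ^ 2 = ∑ i, a i ^ 2 := Equiv.sum_comp σ fun i ↦ a i ^ 2
  have h' : ∑ i, 2 * (a i * a (σ i)) ≤ ∑ i, (a i ^ 2 + a (σ i) ^ 2) :=
    Finset.sum_le_sum fun i _ ↦ by linarith [two_mul_le_add_sq (a i) (a (σ i))]
  rw [← Finset.mul_sum, Finset.sum_add_distrib, h] at h'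
  linarith

/-- for orthogonal projections `Π¹,…,Π^N` and mutually orthogonal
permutations `π_1,…,π_N` of `{1,…,N}`,
`‖Σ_i Πⁱ‖ ≤ Σ_k max_i ‖Πⁱ Π^{π_k(i)}‖`. -/
theorem stmt16 {E : Type*} [NormedAddCommGroup E] [InnerProductSpace ℂ E]
    [FiniteDimensional ℂ E] (N : ℕ)
    (P : Fin N → (E →L[ℂ] E))
    (hsa : ∀ i, IsSelfAdjoint (P i)) (hidem : ∀ i, P i * P i = P i)
    (π : Fin N → Equiv.Perm (Fin N))
    (hπ : ∀ k k', k ≠ k' → ∀ i, π k i ≠ π k' i) :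
    ‖∑ i, P i‖ ≤ ∑ k, ⨆ i, ‖P i * P (π k i)‖ := by
  have hc k : 0 ≤ ⨆ i, ‖P i * P (π k i)‖ := Real.iSup_nonneg fun _ ↦ norm_nonneg _
  have : CompleteSpace E := FiniteDimensional.complete ℂ E
  refine ContinuousLinearMap.opNorm_le_bound _ (Finset.sum_nonneg fun k _ ↦ hc k) fun x ↦ ?_
  set y := (∑ i, P i) x with hy
  have hysum : y = ∑ i, P i x := by rw [hy, sum_apply]
  have hreindex (i : Fin N) : ∑ j, inner ℂ (P i x) (P j x) =
      ∑ k, inner ℂ (P i x) (P (π k i) x) := by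
    have hinj : Function.Injective fun k ↦ π k i := fun k k' h ↦ by
      by_contra hne
      exact hπ k k' hne i h
    exact ((Equiv.ofBijective _ (Finite.injective_iff_bijective.mp hinj)).sum_comp
      fun j ↦ inner ℂ (P i x) (P j x)).symm
  have hyy : inner ℂ y y = ∑ k, ∑ i, inner ℂ (P i x) (P (π k i) x) := by
    rw [Finset.sum_comm, hysum, sum_inner]
    exact Finset.sum_congr rfl fun i _ ↦ by rw [inner_sum, hreindex]
  have hsq : ∑ i, ‖P i x‖ ^ 2 ≤ ‖y‖ * ‖x‖ := by
    have h : (inner ℂ y x) = ((∑ i, ‖P i x‖ ^ 2 : ℝ) : ℂ) := by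
      rw [hysum, sum_inner, Complex.ofReal_sum]
      refine Finset.sum_congr rfl fun i _ ↦ ?_
      have hi : P i (P i x) = P i x := congrArg (· x) (hidem i)
      rw [← hi, ← ContinuousLinearMap.adjoint_inner_right, (hsa i).adjoint_eq, hi,
        inner_self_eq_norm_sq_to_K]
      simp
    have h' := norm_inner_le_norm (𝕜 := ℂ) y x
    rw [h, Complex.norm_real] at h'
    exact (le_abs_self _).trans h'
  have hmain : ‖y‖ * ‖y‖ ≤ (∑ k, ⨆ i, ‖P i * P (π k i)‖) * (‖y‖ * ‖x‖) := by
    calc ‖y‖ * ‖y‖ = ‖(inner ℂ y y : ℂ)‖ := by rw [inner_self_eq_norm_sq_to_K]; simp [sq]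
      _ ≤ ∑ k, ∑ i, ‖(inner ℂ (P i x) (P (π k i) x) : ℂ)‖ := by
        rw [hyy]
        exact (norm_sum_le _ _).trans (Finset.sum_le_sum fun k _ ↦ norm_sum_le _ _)
      _ ≤ ∑ k, ∑ i, (⨆ i, ‖P i * P (π k i)‖) * (‖P i x‖ * ‖P (π k i) x‖) := by
        refine Finset.sum_le_sum fun k _ ↦ Finset.sum_le_sum fun i _ ↦ ?_
        refine (norm_inner_apply_le_of_isSelfAdjoint_of_mul_self (hsa i) (hidem i)
          (hidem _) x).trans ?_
        gcongr
        exact le_ciSup (f := fun i ↦ ‖P i * P (π k i)‖) (Set.finite_range _).bddAbove i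
      _ ≤ ∑ k, (⨆ i, ‖P i * P (π k i)‖) * (‖y‖ * ‖x‖) := by
        refine Finset.sum_le_sum fun k _ ↦ ?_
        rw [← Finset.mul_sum]
        exact mul_le_mul_of_nonneg_left
          ((sum_mul_comp_perm_le_sum_sq (fun i ↦ ‖P i x‖) (π k)).trans hsq) (hc k)
      _ = _ := by rw [Finset.sum_mul]
  rcases (norm_nonneg y).eq_or_lt with h0 | hpos
  · rw [← h0]
    exact mul_nonneg (Finset.sum_nonneg fun k _ ↦ hc k) (norm_nonneg x)
  · exact le_of_mul_le_mul_left (by linarith) hpos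
end
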